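/- In the fragmented-society model, let σ be an essential equilibrium and set α=σ(h,N^h,{0}). If F(ℓ,N)≤F(h,N), then α=1. If F(ℓ,N)>F(h,N), then α≤F(h,N)/F(ℓ,N). -/

import Mathlib

open Finset
open scoped Classical

/-- A policy: `l` (the "populist" policy ℓ) or `h` (the rational policy). -/
inductive Policy where
  | l : Policy
  | h : Policy
  deriving DecidableEq

instance : Fintype Policy :=
  ⟨{Policy.l, Policy.h}, fun x => by cases x <;> simp⟩

/-- A narrative `S ⊆ {0,…,n}`: the first component records whether the policy
variable (index 0) belongs to `S`, the second records `S ∩ N`. -/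
abbrev Narrative (n : ℕ) := Bool × Finset (Fin n)

/-- A platform: a policy, a coalition of social groups, and a narrative. -/
abbrev Platform (n : ℕ) := Policy × Finset (Fin n) × Narrative n

namespace FN

variable {n : ℕ}

/-- The true narrative `S = {0}`. -/
def trueNarr (n : ℕ) : Narrative n := (true, ∅)

/-- The denialist narrative `S = ∅`. -/
def denialNarr (n : ℕ) : Narrative n := (false, ∅)

/-- `x_S(a,C) = x_S(a',C')`: the variables postulated by the narrative `S` take the
same values at `(a,C)` and `(a',C')`. -/
def Agrees (S : Narrative n) (a : Policy) (C : Finset (Fin n))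
    (a' : Policy) (C' : Finset (Fin n)) : Prop :=
  (S.1 = true → a = a') ∧ ∀ i ∈ S.2, (i ∈ C ↔ i ∈ C')

/-- The long-run conditional probability `p_σ(y = 1 ∣ x_S(a,C))`: using
`Pr(y=1∣h) = q`, `Pr(y=1∣ℓ) = 0`, it is `q` times the σ-mass of platforms with
policy `h` agreeing with `(a,C)` on `S`, divided by the σ-mass of all platforms
agreeing with `(a,C)` on `S`. -/
noncomputable def condProb (q : ℝ) (σ : Platform n → ℝ) (a : Policy)
    (C : Finset (Fin n)) (S : Narrative n) : ℝ :=
  (q * ∑ z ∈ univ.filter (fun z : Platform n =>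
      z.1 = Policy.h ∧ Agrees S a C z.1 z.2.1), σ z) /
    ∑ z ∈ univ.filter (fun z : Platform n => Agrees S a C z.1 z.2.1), σ z

/-- The platform payoff `U_σ(a,C,S) = Σ_{i∈C} p_σ(y=1∣x_S(a,C)) · f_i(a)`. -/
noncomputable def payoff (q : ℝ) (f : Fin n → Policy → ℝ) (σ : Platform n → ℝ)
    (z : Platform n) : ℝ :=
  ∑ i ∈ z.2.1, condProb q σ z.1 z.2.1 z.2.2 * f i z.1

/-- A coalition `C` is admissible given policy `a` if it is a nonempty strict
subset of `N` and every member intrinsically supports `a`. -/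
def Admissible (f : Fin n → Policy → ℝ) (a : Policy) (C : Finset (Fin n)) : Prop :=
  C.Nonempty ∧ C ≠ univ ∧ ∀ i ∈ C, 0 < f i a

/-- A valid platform: admissible coalition and feasible narrative. -/
def Valid (f : Fin n → Policy → ℝ) (feas : Narrative n → Prop) (z : Platform n) : Prop :=
  Admissible f z.1 z.2.1 ∧ feas z.2.2

/-- `σ` is a probability distribution over platforms. -/
def IsDist (σ : Platform n → ℝ) : Prop :=
  (∀ z, 0 ≤ σ z) ∧ ∑ z, σ z = 1

/-- An ε-equilibrium: a full-support distribution (over valid platforms) such that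
every platform with probability above ε maximizes the payoff among valid platforms. -/
def EpsEquilibrium (q : ℝ) (f : Fin n → Policy → ℝ) (feas : Narrative n → Prop)
    (ε : ℝ) (σ : Platform n → ℝ) : Prop :=
  IsDist σ ∧ (∀ z, 0 < σ z ↔ Valid f feas z) ∧
    ∀ z, Valid f feas z → ε < σ z →
      ∀ z', Valid f feas z' → payoff q f σ z' ≤ payoff q f σ z

/-- An equilibrium: a (pointwise) limit of ε-equilibria as ε → 0. -/
def Equilibrium (q : ℝ) (f : Fin n → Policy → ℝ) (feas : Narrative n → Prop)
    (σ : Platform n → ℝ) : Prop :=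
  ∃ (ε : ℕ → ℝ) (σs : ℕ → Platform n → ℝ),
    (∀ k, 0 < ε k) ∧ Filter.Tendsto ε Filter.atTop (nhds 0) ∧
    (∀ k, EpsEquilibrium q f feas (ε k) (σs k)) ∧
    (∀ z, Filter.Tendsto (fun k => σs k z) Filter.atTop (nhds (σ z)))

/-- An essential equilibrium: supported platforms with a false narrative strictly
outperform the true narrative on the same policy-coalition pair, and supported
narratives `S ⊆ N` strictly outperform all strict subset narratives. -/
def Essential (q : ℝ) (f : Fin n → Policy → ℝ) (feas : Narrative n → Prop)
    (σ : Platform n → ℝ) : Prop :=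
  Equilibrium q f feas σ ∧
  (∀ a C (S : Narrative n), 0 < σ (a, C, S) → S ≠ trueNarr n →
      payoff q f σ (a, C, trueNarr n) < payoff q f σ (a, C, S)) ∧
  (∀ a C (S : Finset (Fin n)), 0 < σ (a, C, ((false, S) : Narrative n)) →
      ∀ S' : Finset (Fin n), S' ⊂ S →
        payoff q f σ (a, C, ((false, S') : Narrative n)) <
          payoff q f σ (a, C, ((false, S) : Narrative n)))

/-- `N^a`: the set of groups with positive mobilization potential for `a`. -/
noncomputable def Nset (f : Fin n → Policy → ℝ) (a : Policy) : Finset (Fin n) :=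
  univ.filter (fun i => 0 < f i a)

/-- `F(a,M) = Σ_{i∈M} f_i(a)`: the aggregate mobilization potential for `a` in `M`. -/
def Fval (f : Fin n → Policy → ℝ) (a : Policy) (M : Finset (Fin n)) : ℝ :=
  ∑ i ∈ M, f i a

/-- Standing assumptions on the mobilization potentials: nonnegativity, every group
supports some policy, every policy is supported by some group. -/
def FOK (f : Fin n → Policy → ℝ) : Prop :=
  (∀ i a, 0 ≤ f i a) ∧ (∀ i, ∃ a, 0 < f i a) ∧ (∀ a, ∃ i, 0 < f i a)

/-- Standing assumptions on the family `𝒮` in the fragmented-society model. -/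
def FamilyOK (f : Fin n → Policy → ℝ) (𝒮 : Finset (Finset (Fin n))) : Prop :=
  (univ \ Nset f Policy.h).Nonempty ∧ (univ \ Nset f Policy.l).Nonempty ∧
  (Nset f Policy.l ∩ Nset f Policy.h).Nonempty ∧
  univ \ Nset f Policy.h ∈ 𝒮 ∧ univ \ Nset f Policy.l ∈ 𝒮 ∧
  Nset f Policy.l ∩ Nset f Policy.h ∈ 𝒮 ∧ (∅ : Finset (Fin n)) ∈ 𝒮 ∧
  ∀ S ∈ 𝒮, S ⊆ univ \ Nset f Policy.h ∨ S ⊆ univ \ Nset f Policy.l ∨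
    S ⊆ Nset f Policy.l ∩ Nset f Policy.h

/-- In the fragmented-society model, a narrative is feasible iff `S ∖ {0} ∈ 𝒮`. -/
def fragFeas (𝒮 : Finset (Finset (Fin n))) : Narrative n → Prop :=
  fun S => S.2 ∈ 𝒮

end FN

namespace FN
variable {n : ℕ}

lemma payoff_eq (q : ℝ) (f : Fin n → Policy → ℝ) (σ : Platform n → ℝ) (z : Platform n) :
    payoff q f σ z = condProb q σ z.1 z.2.1 z.2.2 * Fval f z.1 z.2.1 := by
  unfold payoff Fval
  rw [Finset.mul_sum]

lemma agrees_self (S : Narrative n) (a : Policy) (C : Finset (Fin n)) : Agrees S a C a C :=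
  ⟨fun _ => rfl, fun _ _ => Iff.rfl⟩

lemma condProb_le {q : ℝ} (hq : 0 < q) {σ : Platform n → ℝ} (h0 : ∀ z, 0 ≤ σ z)
    (a : Policy) (C : Finset (Fin n)) (S : Narrative n) : condProb q σ a C S ≤ q := by
  unfold condProb
  apply div_le_of_le_mul₀ (Finset.sum_nonneg fun z _ => h0 z) hq.le
  apply mul_le_mul_of_nonneg_left _ hq.le
  apply Finset.sum_le_sum_of_subset_of_nonneg
  · intro z hz
    simp only [Finset.mem_filter] at hz ⊢
    exact ⟨hz.1, hz.2.2⟩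
  · intro z _ _
    exact h0 z

lemma condProb_lt {q : ℝ} (hq : 0 < q) {σ : Platform n → ℝ} (h0 : ∀ z, 0 ≤ σ z)
    (C : Finset (Fin n)) (S : Narrative n) (hz : 0 < σ (Policy.l, C, S)) :
    condProb q σ Policy.l C S < q := by
  unfold condProb
  have hm : (Policy.l, C, S) ∈ univ.filter
      (fun z : Platform n => Agrees S Policy.l C z.1 z.2.1) := by
    simp only [Finset.mem_filter, Finset.mem_univ, true_and]
    exact agrees_self _ _ _
  have hpos : 0 < ∑ z ∈ univ.filter
      (fun z : Platform n => Agrees S Policy.l C z.1 z.2.1), σ z :=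
    Finset.sum_pos' (fun z _ => h0 z) ⟨_, hm, hz⟩
  rw [div_lt_iff₀ hpos]
  apply mul_lt_mul_of_pos_left _ hq
  apply Finset.sum_lt_sum_of_subset _ hm _ hz (fun z _ _ => h0 z)
  · intro z hz
    simp only [Finset.mem_filter] at hz ⊢
    exact ⟨hz.1, hz.2.2⟩
  · simp

lemma condProb_true {q : ℝ} {σ : Platform n → ℝ} (h0 : ∀ z, 0 ≤ σ z)
    (C C' : Finset (Fin n)) (S : Narrative n) (hz : 0 < σ (Policy.h, C', S)) :
    condProb q σ Policy.h C (trueNarr n) = q := by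
  unfold condProb
  have e : univ.filter (fun z : Platform n =>
      z.1 = Policy.h ∧ Agrees (trueNarr n) Policy.h C z.1 z.2.1) =
      univ.filter (fun z : Platform n => Agrees (trueNarr n) Policy.h C z.1 z.2.1) := by
    ext z
    simp only [Finset.mem_filter, Finset.mem_univ, true_and, Agrees, trueNarr]
    constructor
    · exact fun h => h.2
    · exact fun h => ⟨(h.1 trivial).symm, h⟩
  rw [e]
  have hpos : 0 < ∑ z ∈ univ.filter
      (fun z : Platform n => Agrees (trueNarr n) Policy.h C z.1 z.2.1), σ z :=
    Finset.sum_pos' (fun z _ => h0 z) ⟨(Policy.h, C', S), by simp [Agrees, trueNarr], hz⟩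
  field_simp

lemma condProb_denial {q : ℝ} (hq : 0 < q) {σ : Platform n → ℝ} (h0 : ∀ z, 0 ≤ σ z)
    (h1 : ∑ z, σ z = 1) (a : Policy) (C C' : Finset (Fin n)) (S : Narrative n) :
    q * σ (Policy.h, C', S) ≤ condProb q σ a C (denialNarr n) := by
  unfold condProb
  have e : univ.filter (fun z : Platform n => Agrees (denialNarr n) a C z.1 z.2.1) = univ := by
    ext z
    simp [Agrees, denialNarr]
  rw [e, h1, div_one]
  apply mul_le_mul_of_nonneg_left _ hq.le
  exact Finset.single_le_sum (f := σ) (fun z _ => h0 z) (by simp [Agrees, denialNarr])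

lemma Fval_Nset {f : Fin n → Policy → ℝ} (hf : FOK f) (a : Policy) :
    Fval f a (Nset f a) = Fval f a univ := by
  unfold Fval Nset
  apply Finset.sum_subset (Finset.subset_univ _)
  intro i _ hi
  simp only [Finset.mem_filter, Finset.mem_univ, true_and, not_lt] at hi
  exact le_antisymm hi (hf.1 i a)

lemma valid_Nset {f : Fin n → Policy → ℝ} (hf : FOK f) {𝒮 : Finset (Finset (Fin n))}
    (a : Policy) (h : (univ \ Nset f a).Nonempty) (he : (∅ : Finset (Fin n)) ∈ 𝒮) (b : Bool) :
    Valid f (fragFeas 𝒮) (a, Nset f a, (b, ∅)) := by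
  refine ⟨⟨?_, ?_, ?_⟩, he⟩
  · obtain ⟨i, hi⟩ := hf.2.2 a
    exact ⟨i, by simp [Nset, hi]⟩
  · intro e
    simp only at e
    rw [e] at h
    simp at h
  · intro i hi
    simpa [Nset] using hi

end FN

/-- In the fragmented-society model, let `σ` be an essential
equilibrium and set `α = σ(h,N^h,{0})`. If `F(ℓ,N) ≤ F(h,N)`, then `α = 1`. If
`F(ℓ,N) > F(h,N)`, then `α ≤ F(h,N)/F(ℓ,N)`. -/
theorem frag_alpha_bounds
    (n : ℕ) (q : ℝ) (hq0 : 0 < q) (hq1 : q ≤ 1)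
    (f : Fin n → Policy → ℝ) (hf : FN.FOK f)
    (𝒮 : Finset (Finset (Fin n))) (h𝒮 : FN.FamilyOK f 𝒮)
    (σ : Platform n → ℝ) (hσ : FN.Essential q f (FN.fragFeas 𝒮) σ) :
    (FN.Fval f Policy.l univ ≤ FN.Fval f Policy.h univ →
        σ (Policy.h, FN.Nset f Policy.h, FN.trueNarr n) = 1) ∧
    (FN.Fval f Policy.h univ < FN.Fval f Policy.l univ →
        σ (Policy.h, FN.Nset f Policy.h, FN.trueNarr n) ≤
          FN.Fval f Policy.h univ / FN.Fval f Policy.l univ) := by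
  obtain ⟨⟨ε, σs, hε, hε0, heq, hlim⟩, hess, -⟩ := hσ
  obtain ⟨hNh, hNl, -, -, -, -, hemp, -⟩ := h𝒮
  have hvh := FN.valid_Nset hf Policy.h hNh hemp true
  have hvl := FN.valid_Nset hf Policy.l hNl hemp false
  have h0 : ∀ z, 0 ≤ σ z := fun z =>
    ge_of_tendsto' (hlim z) fun k => (heq k).1.1 z
  have h1 : ∑ z, σ z = 1 := by
    have := tendsto_finsetSum (Finset.univ : Finset (Platform n)) fun z _ => hlim z
    refine tendsto_nhds_unique this ?_
    simp only [(heq _).1.2]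
    exact tendsto_const_nhds
  have hev : ∀ z, 0 < σ z → ∀ᶠ k in Filter.atTop, ε k < σs k z := fun z hz =>
    hε0.eventually_lt (hlim z) hz
  -- payoff of the rational platform
  have hpay : ∀ k, ∀ C, FN.payoff q f (σs k) (Policy.h, C, FN.trueNarr n)
      = q * FN.Fval f Policy.h C := by
    intro k C
    rw [FN.payoff_eq]
    simp only
    rw [FN.condProb_true (heq k).1.1 C _ _ (((heq k).2.1 _).2 hvh)]
  constructor
  · intro hF
    rw [← h1]
    symm
    apply Finset.sum_eq_single_of_mem _ (Finset.mem_univ _)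
    rintro ⟨a, C, S⟩ - hne
    by_contra hz0
    have hz : 0 < σ (a, C, S) := lt_of_le_of_ne (h0 _) (Ne.symm hz0)
    obtain ⟨k, hk⟩ := (hev _ hz).exists
    have hkpos := (hε k).trans hk
    have hv := ((heq k).2.1 _).1 hkpos
    have hmax := (heq k).2.2 _ hv hk _ hvh
    have hmax' : q * FN.Fval f Policy.h univ ≤ FN.payoff q f (σs k) (a, C, S) := by
      rw [← FN.Fval_Nset hf, ← hpay k]
      exact hmax
    obtain ⟨⟨hCne, -, hCpos⟩, -⟩ := hv
    have hFC : 0 < FN.Fval f a C := Finset.sum_pos hCpos hCne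
    cases a with
    | l =>
      rw [FN.payoff_eq] at hmax'
      have hlt := FN.condProb_lt hq0 (heq k).1.1 C S hkpos
      have hle : FN.Fval f Policy.l C ≤ FN.Fval f Policy.l univ :=
        Finset.sum_le_sum_of_subset_of_nonneg (Finset.subset_univ _) fun i _ _ => hf.1 i _
      have h2 := mul_lt_mul_of_pos_right hlt hFC
      have h3 := mul_le_mul_of_nonneg_left (hle.trans hF) hq0.le
      simp only at hmax'
      linarith
    | h =>
      by_cases hS : S = FN.trueNarr n
      · subst hS
        rw [hpay] at hmax'
        have h2 := le_of_mul_le_mul_left hmax' hq0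
        apply hne
        have hsub : C ⊆ FN.Nset f Policy.h := fun i hi => by
          simpa [FN.Nset] using hCpos i hi
        have : C = FN.Nset f Policy.h := by
          apply Finset.Subset.antisymm hsub
          intro i hi
          by_contra hiC
          have : FN.Fval f Policy.h C < FN.Fval f Policy.h univ :=
            Finset.sum_lt_sum_of_subset (Finset.subset_univ _) (Finset.mem_univ i) hiC
              (by simpa [FN.Nset] using hi) fun j _ _ => hf.1 j _
          linarith
        rw [this]
      · have h2 := hess _ _ _ hz hS
        rw [FN.payoff_eq, FN.payoff_eq] at h2
        simp only at h2
        rw [FN.condProb_true h0 C _ _ hz] at h2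
        have h3 := mul_le_mul_of_nonneg_right (FN.condProb_le hq0 h0 Policy.h C S) hFC.le
        linarith
  · intro hF
    have hFh : 0 ≤ FN.Fval f Policy.h univ := Finset.sum_nonneg fun i _ => hf.1 i _
    have hFl := hFh.trans_lt hF
    rcases (h0 (Policy.h, FN.Nset f Policy.h, FN.trueNarr n)).eq_or_lt with hz | hz
    · rw [← hz]
      positivity
    · refine le_of_tendsto (hlim _) ?_
      filter_upwards [hev _ hz] with k hk
      have hmax := (heq k).2.2 _ hvh hk _ hvl
      have hmax' := hmax.trans_eq (hpay k _)
      rw [FN.payoff_eq] at hmax'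
      simp only [FN.Fval_Nset hf] at hmax'
      have h2 := FN.condProb_denial hq0 (heq k).1.1 (heq k).1.2 Policy.l
        (FN.Nset f Policy.l) (FN.Nset f Policy.h) (FN.trueNarr n)
      have h3 := (mul_le_mul_of_nonneg_right h2 hFl.le).trans hmax'
      rw [le_div_iff₀ hFl]
      rw [mul_assoc] at h3
      exact le_of_mul_le_mul_left h3 hq0
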